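/- arXiv:2411.01370 — 2 statements merged into one kernel-verified Lean document; each statement's English description precedes it below -/
import Mathlib

section
/- (Proposition 2, two-stage part.) Let ŷ : 𝒯 → ℝ^J and û : 𝒯∖{r} → ℝ be given with b_n := B_{τ(n)} ŷ_n ≥ 0 componentwise for every node n, and set b̄_n := max_{l∈𝒯_{τ(n)}} b_l (componentwise maximum over all nodes of the same stage). Then the constructed pair (x^TS, η^TS) is feasible for SP-RTS(ŷ,û) (in particular x^TS_m = x^TS_n whenever τ(m) = τ(n)), and it is optimal: every feasible (x, η) of SP-RTS(ŷ,û) satisfies G(x,η) ≥ G(x^TS,η^TS). Consequently Q^T(ŷ,û) = ∑_{n∈𝒯} p_n ( f̃_n · max_{m∈𝒫(n)} ⌈b̄_m⌉ + λ̃_n · max_{m∈𝒞(n)} ( f_{τ(m)} · max_{l∈𝒫(m)} ⌈b̄_l⌉ + c_{τ(m)} · ŷ_m − û_m ) ), with the λ̃-term omitted at leaves. -/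
open Finset

/-- A scenario tree with `T` stages: a finite nonempty set of nodes with a root,
a parent map fixing the root, a stage map decreasing by one along the parent map,
such that every node reaches the root by iterating the parent map, and every
non-leaf node has a child. -/
structure STree (T : ℕ) : Type 1 where
  Node : Type
  fin : Fintype Node
  deceq : DecidableEq Node
  root : Node
  parent : Node → Node
  stage : Node → ℕ
  hT : 1 ≤ T
  parent_root : parent root = root
  stage_root : stage root = 1
  stage_ge : ∀ n, 1 ≤ stage n
  stage_le : ∀ n, stage n ≤ T
  stage_parent : ∀ n, n ≠ root → stage (parent n) = stage n - 1
  reaches_root : ∀ n, ∃ k, parent^[k] n = root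
  children_ne : ∀ n, stage n ≠ T → ∃ m, m ≠ root ∧ parent m = n

attribute [instance] STree.fin STree.deceq

namespace STree

variable {T : ℕ} (S : STree T)

/-- The path set `𝒫(n) = {aᵏ(n) : k ≥ 0}` of a node. -/
def path (n : S.Node) : Finset S.Node :=
  (Finset.range T).image fun k => S.parent^[k] n

theorem path_nonempty (n : S.Node) : (S.path n).Nonempty :=
  ⟨n, Finset.mem_image.mpr ⟨0, Finset.mem_range.mpr S.hT, rfl⟩⟩

/-- The children `𝒞(n)` of a node. -/
def children (n : S.Node) : Finset S.Node :=
  Finset.univ.filter fun m => m ≠ S.root ∧ S.parent m = n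

theorem children_nonempty {n : S.Node} (h : S.stage n ≠ T) : (S.children n).Nonempty := by
  obtain ⟨m, h1, h2⟩ := S.children_ne n h
  exact ⟨m, Finset.mem_filter.mpr ⟨Finset.mem_univ m, h1, h2⟩⟩

/-- The set `𝒯ₛ` of stage-`s` nodes. -/
def stageNodes (s : ℕ) : Finset S.Node :=
  Finset.univ.filter fun n => S.stage n = s

theorem stageNodes_self_nonempty (n : S.Node) : (S.stageNodes (S.stage n)).Nonempty :=
  ⟨n, Finset.mem_filter.mpr ⟨Finset.mem_univ n, rfl⟩⟩

end STree

section Constructions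

variable {T M J : ℕ}

/-- `b_n = B_{τ(n)} ŷ_n` (componentwise). -/
noncomputable def bvec (S : STree T) (B : ℕ → Matrix (Fin M) (Fin J) ℝ)
    (yh : S.Node → Fin J → ℝ) (n : S.Node) (i : Fin M) : ℝ :=
  (B (S.stage n)).mulVec (yh n) i

/-- Componentwise maximum of `b` over all nodes of the same stage as `n`
(used for `b̄_n = max_{l ∈ 𝒯_{τ(n)}} b_l`). -/
noncomputable def stageMax (S : STree T) (b : S.Node → Fin M → ℝ) (n : S.Node) (i : Fin M) : ℝ :=
  (S.stageNodes (S.stage n)).sup' (S.stageNodes_self_nonempty n) fun l => b l i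

/-- `max_{m ∈ 𝒫(n)} ⌈b_m⌉` (componentwise). -/
noncomputable def pmc (S : STree T) (b : S.Node → Fin M → ℝ) (n : S.Node) (i : Fin M) : ℤ :=
  (S.path n).sup' (S.path_nonempty n) fun m => ⌈b m i⌉

/-- `max_{m ∈ 𝒫(n)} b_m` (componentwise, no rounding). -/
noncomputable def pm (S : STree T) (b : S.Node → Fin M → ℝ) (n : S.Node) (i : Fin M) : ℝ :=
  (S.path n).sup' (S.path_nonempty n) fun m => b m i

end Constructions

section Substructure

variable {T M J : ℕ}

/-- Feasibility for the substructure problem SP-RMS(ŷ,û). -/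
def FeasSP (S : STree T) (f : ℕ → Fin M → ℝ) (c : ℕ → Fin J → ℝ)
    (B : ℕ → Matrix (Fin M) (Fin J) ℝ)
    (yh : S.Node → Fin J → ℝ) (uh : S.Node → ℝ)
    (x : S.Node → Fin M → ℤ) (η : S.Node → ℝ) : Prop :=
  (∀ n i, 0 ≤ x n i) ∧
  (∀ n i, (B (S.stage n)).mulVec (yh n) i ≤ ∑ m ∈ S.path n, (x m i : ℝ)) ∧
  ∀ n, n ≠ S.root →
    (∑ i, f (S.stage n) i * ∑ m ∈ S.path n, (x m i : ℝ))
      + (∑ j, c (S.stage n) j * yh n j) - uh n ≤ η (S.parent n)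

/-- Objective `G(x,η) = ∑_n p_n ( f̃_n · ∑_{m∈𝒫(n)} x_m + λ̃_n η_n )` of the
substructure problem, where `f̃` and `λ̃` are the derived coefficients. -/
noncomputable def Gobj (S : STree T) (p : S.Node → ℝ) (f : ℕ → Fin M → ℝ) (lam : ℕ → ℝ)
    (x : S.Node → Fin M → ℤ) (η : S.Node → ℝ) : ℝ :=
  ∑ n, p n *
    ((∑ i, (if n = S.root then f 1 i else (1 - lam (S.stage n)) * f (S.stage n) i)
        * ∑ m ∈ S.path n, (x m i : ℝ))
     + (if S.stage n = T then 0 else lam (S.stage n + 1)) * η n)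

end Substructure

/-- Feasibility for the two-stage substructure problem SP-RTS(ŷ,û): SP-RMS
feasibility plus the constraint that `x` is identical across nodes of the same stage. -/
def FeasTS {T M J : ℕ} (S : STree T) (f : ℕ → Fin M → ℝ) (c : ℕ → Fin J → ℝ)
    (B : ℕ → Matrix (Fin M) (Fin J) ℝ)
    (yh : S.Node → Fin J → ℝ) (uh : S.Node → ℝ)
    (x : S.Node → Fin M → ℤ) (η : S.Node → ℝ) : Prop :=
  FeasSP S f c B yh uh x η ∧ ∀ m n, S.stage m = S.stage n → x m = x n

namespace STree

variable {T : ℕ} (S : STree T)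

theorem node_induction {P : S.Node → Prop} (root : P S.root)
    (step : ∀ n, n ≠ S.root → P (S.parent n) → P n) (n : S.Node) : P n := by
  obtain ⟨k, hk⟩ := S.reaches_root n
  induction k generalizing n with
  | zero =>
    obtain rfl : n = S.root := hk
    exact root
  | succ k ih =>
    by_cases hn : n = S.root
    · exact hn ▸ root
    · exact step n hn (ih _ hk)

theorem stage_parent_add_one {n : S.Node} (hn : n ≠ S.root) :
    S.stage (S.parent n) + 1 = S.stage n := by
  have := S.stage_parent n hn
  have := S.stage_ge (S.parent n)
  omega

theorem ne_root_of_stage_eq {m n : S.Node} (h : S.stage m = S.stage n) (hn : n ≠ S.root) :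
    m ≠ S.root := by
  rintro rfl
  have := S.stage_parent_add_one hn
  have := S.stage_ge (S.parent n)
  have := S.stage_root
  omega

theorem stage_parent_eq {m n : S.Node} (h : S.stage m = S.stage n) (hn : n ≠ S.root) :
    S.stage (S.parent m) = S.stage (S.parent n) := by
  have := S.stage_parent_add_one hn
  have := S.stage_parent_add_one (S.ne_root_of_stage_eq h hn)
  omega

theorem eq_root_of_stage_eq {m : S.Node} (h : S.stage m = S.stage S.root) : m = S.root := by
  by_contra hm
  exact S.ne_root_of_stage_eq h.symm hm rfl

theorem iterate_parent_root (k : ℕ) : S.parent^[k] S.root = S.root :=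
  Function.iterate_fixed S.parent_root k

theorem iterate_parent_eq_root (n : S.Node) :
    ∀ k, S.stage n ≤ k + 1 → S.parent^[k] n = S.root := by
  induction n using S.node_induction with
  | root => exact fun k _ => S.iterate_parent_root k
  | step n hn ih =>
    intro k hk
    have h1 := S.stage_parent_add_one hn
    have h2 := S.stage_ge (S.parent n)
    obtain ⟨k, rfl⟩ : ∃ j, k = j + 1 := ⟨k - 1, by omega⟩
    exact ih k (by omega)

theorem mem_path {m n : S.Node} : m ∈ S.path n ↔ ∃ k, S.parent^[k] n = m := by
  simp only [path, Finset.mem_image, Finset.mem_range]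
  refine ⟨fun ⟨k, _, hk⟩ => ⟨k, hk⟩, fun ⟨k, hk⟩ => ?_⟩
  by_cases hkT : k < T
  · exact ⟨k, hkT, hk⟩
  · have hT := S.hT
    have hn := S.stage_le n
    refine ⟨T - 1, by omega, ?_⟩
    rw [← hk, S.iterate_parent_eq_root n k (by omega),
      S.iterate_parent_eq_root n (T - 1) (by omega)]

theorem path_root : S.path S.root = {S.root} := by
  ext m
  simp [mem_path, iterate_parent_root, eq_comm]

theorem path_eq_insert (n : S.Node) : S.path n = insert n (S.path (S.parent n)) := by
  ext m
  rw [Finset.mem_insert, mem_path, mem_path]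
  constructor
  · rintro ⟨_ | k, hk⟩
    · exact Or.inl hk.symm
    · exact Or.inr ⟨k, hk⟩
  · rintro (rfl | ⟨k, hk⟩)
    · exact ⟨0, rfl⟩
    · exact ⟨k + 1, hk⟩

theorem stage_le_of_mem_path (n : S.Node) : ∀ m ∈ S.path n, S.stage m ≤ S.stage n := by
  induction n using S.node_induction with
  | root => simp [path_root]
  | step n hn ih =>
    intro m hm
    rw [path_eq_insert, Finset.mem_insert] at hm
    rcases hm with rfl | hm
    · exact le_rfl
    · have := ih m hm
      have := S.stage_parent_add_one hn
      omega

theorem notMem_path_parent {n : S.Node} (hn : n ≠ S.root) : n ∉ S.path (S.parent n) := by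
  intro h
  have := S.stage_le_of_mem_path _ _ h
  have := S.stage_parent_add_one hn
  omega

theorem sum_path {R : Type*} [AddCommMonoid R] (g : S.Node → R) {n : S.Node} (hn : n ≠ S.root) :
    ∑ m ∈ S.path n, g m = g n + ∑ m ∈ S.path (S.parent n), g m := by
  rw [S.path_eq_insert n, Finset.sum_insert (S.notMem_path_parent hn)]

theorem sum_path_congr_stage {R : Type*} [AddCommMonoid R] {g : S.Node → R}
    (hg : ∀ m n, S.stage m = S.stage n → g m = g n) (n : S.Node) :
    ∀ m, S.stage m = S.stage n → ∑ l ∈ S.path m, g l = ∑ l ∈ S.path n, g l := by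
  induction n using S.node_induction with
  | root => intro m hm; rw [S.eq_root_of_stage_eq hm]
  | step n hn ih =>
    intro m hm
    rw [S.sum_path g hn, S.sum_path g (S.ne_root_of_stage_eq hm hn), hg m n hm,
      ih _ (S.stage_parent_eq hm hn)]

end STree

section Constructions

variable {T M : ℕ} (S : STree T) (b : S.Node → Fin M → ℝ)

theorem stageMax_congr {m n : S.Node} (h : S.stage m = S.stage n) :
    stageMax S b m = stageMax S b n := by
  funext i
  simp only [stageMax, h]

theorem le_stageMax (n : S.Node) (i : Fin M) : b n i ≤ stageMax S b n i :=
  Finset.le_sup' (fun l => b l i) (by simp [STree.stageNodes])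

theorem pmc_root (i : Fin M) : pmc S b S.root i = ⌈b S.root i⌉ := by
  simp [pmc, STree.path_root]

theorem pmc_eq_max_parent (n : S.Node) (i : Fin M) :
    pmc S b n i = max ⌈b n i⌉ (pmc S b (S.parent n) i) := by
  simp only [pmc, S.path_eq_insert n]
  rw [Finset.sup'_insert (H := S.path_nonempty _)]

theorem ceil_le_pmc (n : S.Node) (i : Fin M) : ⌈b n i⌉ ≤ pmc S b n i := by
  rw [pmc_eq_max_parent]
  exact le_max_left _ _

variable {b}

theorem pmc_congr_stage (hb : ∀ m n, S.stage m = S.stage n → b m = b n) (n : S.Node) :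
    ∀ m, S.stage m = S.stage n → pmc S b m = pmc S b n := by
  induction n using S.node_induction with
  | root => intro m hm; rw [S.eq_root_of_stage_eq hm]
  | step n hn ih =>
    intro m hm
    funext i
    rw [pmc_eq_max_parent, pmc_eq_max_parent S b n, hb m n hm, ih _ (S.stage_parent_eq hm hn)]

theorem sum_path_eq_pmc {x : S.Node → Fin M → ℤ}
    (hxr : ∀ i, x S.root i = ⌈b S.root i⌉)
    (hxn : ∀ n, n ≠ S.root → ∀ i, x n i = pmc S b n i - pmc S b (S.parent n) i)
    (n : S.Node) (i : Fin M) : ∑ m ∈ S.path n, x m i = pmc S b n i := by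
  induction n using S.node_induction with
  | root => simp [STree.path_root, hxr, pmc_root]
  | step n hn ih => rw [S.sum_path _ hn, ih, hxn n hn, sub_add_cancel]

theorem pmc_le_sum_path {x : S.Node → Fin M → ℤ} (hx : ∀ n i, 0 ≤ x n i)
    (hbx : ∀ n i, b n i ≤ ∑ m ∈ S.path n, (x m i : ℝ)) (n : S.Node) (i : Fin M) :
    pmc S b n i ≤ ∑ m ∈ S.path n, x m i := by
  have hceil (n : S.Node) : ⌈b n i⌉ ≤ ∑ m ∈ S.path n, x m i := by
    rw [Int.ceil_le]
    exact_mod_cast hbx n i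
  induction n using S.node_induction with
  | root => rw [pmc_root]; exact hceil _
  | step n hn ih =>
    rw [pmc_eq_max_parent]
    refine max_le (hceil n) (ih.trans ?_)
    rw [S.sum_path _ hn]
    exact le_add_of_nonneg_left (hx n i)

end Constructions

section TwoStage

variable {T M J : ℕ} (S : STree T) {f : ℕ → Fin M → ℝ} {c : ℕ → Fin J → ℝ}
  {B : ℕ → Matrix (Fin M) (Fin J) ℝ} {yh : S.Node → Fin J → ℝ} {uh : S.Node → ℝ}

theorem FeasTS.stageMax_le_sum_path {x : S.Node → Fin M → ℤ} {η : S.Node → ℝ}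
    (h : FeasTS S f c B yh uh x η) (n : S.Node) (i : Fin M) :
    stageMax S (bvec S B yh) n i ≤ ∑ m ∈ S.path n, (x m i : ℝ) := by
  refine Finset.sup'_le _ _ fun l hl => ?_
  have hl : S.stage l = S.stage n := by simpa [STree.stageNodes] using hl
  refine (h.1.2.1 l i).trans_eq ?_
  exact S.sum_path_congr_stage (g := fun m => (x m i : ℝ))
    (fun m n hmn => by rw [h.2 m n hmn]) n l hl

theorem FeasTS.pmc_le_sum_path {x : S.Node → Fin M → ℤ} {η : S.Node → ℝ}
    (h : FeasTS S f c B yh uh x η) (n : S.Node) (i : Fin M) :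
    (pmc S (stageMax S (bvec S B yh)) n i : ℝ) ≤ ∑ m ∈ S.path n, (x m i : ℝ) := by
  exact_mod_cast _root_.pmc_le_sum_path S h.1.1 (h.stageMax_le_sum_path S) n i

theorem Gobj_le_Gobj {p : S.Node → ℝ} {lam : ℕ → ℝ} (hp : ∀ n, 0 ≤ p n)
    (hf : ∀ s, 1 ≤ s → s ≤ T → ∀ i, 0 ≤ f s i)
    (hlam : ∀ s, 2 ≤ s → s ≤ T → 0 ≤ lam s ∧ lam s ≤ 1)
    {x x' : S.Node → Fin M → ℤ} {η η' : S.Node → ℝ}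
    (hx : ∀ n i, ∑ m ∈ S.path n, (x m i : ℝ) ≤ ∑ m ∈ S.path n, (x' m i : ℝ))
    (hη : ∀ n, S.stage n ≠ T → η n ≤ η' n) :
    Gobj S p f lam x η ≤ Gobj S p f lam x' η' := by
  refine Finset.sum_le_sum fun n _ => mul_le_mul_of_nonneg_left (add_le_add ?_ ?_) (hp n)
  · refine Finset.sum_le_sum fun i _ => mul_le_mul_of_nonneg_left (hx n i) ?_
    split_ifs with hn
    · exact hf 1 le_rfl S.hT i
    · have h1 := S.stage_parent_add_one hn
      have h2 := S.stage_ge (S.parent n)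
      exact mul_nonneg (sub_nonneg.2 (hlam _ (by omega) (S.stage_le n)).2)
        (hf _ (S.stage_ge n) (S.stage_le n) i)
  · split_ifs with hn
    · simp
    · have h1 := S.stage_ge n
      have h2 := S.stage_le n
      exact mul_le_mul_of_nonneg_left (hη n hn) (hlam _ (by omega) (by omega)).1

end TwoStage

/-- Proposition 2, two-stage part: the constructed pair
`(x^TS, η^TS)` (built from `b̄_n = max_{l∈𝒯_{τ(n)}} b_l`) is feasible and
optimal for SP-RTS(ŷ,û), and consequently the optimal value `Q^T(ŷ,û)` equals
the stated closed form. -/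
theorem sp_rts_solution {T M J : ℕ} (S : STree T)
    (p : S.Node → ℝ) (f : ℕ → Fin M → ℝ) (c : ℕ → Fin J → ℝ)
    (B : ℕ → Matrix (Fin M) (Fin J) ℝ) (lam : ℕ → ℝ)
    (hp : ∀ n, 0 ≤ p n)
    (hp1 : ∀ s, 1 ≤ s → s ≤ T → ∑ n ∈ S.stageNodes s, p n = 1)
    (hpc : ∀ n, S.stage n ≠ T → ∑ m ∈ S.children n, p m = p n)
    (hf : ∀ s, 1 ≤ s → s ≤ T → ∀ i, 0 ≤ f s i)
    (hlam : ∀ s, 2 ≤ s → s ≤ T → 0 ≤ lam s ∧ lam s ≤ 1)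
    (yh : S.Node → Fin J → ℝ) (uh : S.Node → ℝ)
    (hb : ∀ n i, 0 ≤ bvec S B yh n i)
    (xTS : S.Node → Fin M → ℤ) (etaTS : S.Node → ℝ)
    (hxr : ∀ i, xTS S.root i = ⌈stageMax S (bvec S B yh) S.root i⌉)
    (hxn : ∀ n, n ≠ S.root → ∀ i,
      xTS n i = pmc S (stageMax S (bvec S B yh)) n i
              - pmc S (stageMax S (bvec S B yh)) (S.parent n) i)
    (heta : ∀ n (hn : S.stage n ≠ T), etaTS n =
      (S.children n).sup' (S.children_nonempty hn) fun m =>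
        (∑ i, f (S.stage m) i * ∑ l ∈ S.path m, (xTS l i : ℝ))
          + (∑ j, c (S.stage m) j * yh m j) - uh m) :
    FeasTS S f c B yh uh xTS etaTS ∧
    (∀ x η, FeasTS S f c B yh uh x η → Gobj S p f lam xTS etaTS ≤ Gobj S p f lam x η) ∧
    sInf {v : ℝ | ∃ x η, FeasTS S f c B yh uh x η ∧ v = Gobj S p f lam x η} =
      ∑ n, p n *
        ((∑ i, (if n = S.root then f 1 i else (1 - lam (S.stage n)) * f (S.stage n) i) *
            ((pmc S (stageMax S (bvec S B yh)) n i : ℝ)))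
         + (if hn : S.stage n = T then 0 else lam (S.stage n + 1) *
             (S.children n).sup' (S.children_nonempty hn) fun m =>
               (∑ i, f (S.stage m) i * (pmc S (stageMax S (bvec S B yh)) m i : ℝ))
                 + (∑ j, c (S.stage m) j * yh m j) - uh m)) := by
  have hstage (m n : S.Node) (h : S.stage m = S.stage n) :
      stageMax S (bvec S B yh) m = stageMax S (bvec S B yh) n := stageMax_congr S _ h
  have hsum (n : S.Node) (i : Fin M) :
      ∑ m ∈ S.path n, (xTS m i : ℝ) = (pmc S (stageMax S (bvec S B yh)) n i : ℝ) := by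
    exact_mod_cast sum_path_eq_pmc S hxr hxn n i
  have hfeas : FeasTS S f c B yh uh xTS etaTS := by
    refine ⟨⟨fun n i => ?_, fun n i => ?_, fun n hn => ?_⟩, fun m n hmn => ?_⟩
    · by_cases hn : n = S.root
      · rw [hn, hxr]
        exact Int.ceil_nonneg ((hb _ i).trans (le_stageMax S _ _ i))
      · rw [hxn n hn, sub_nonneg, pmc_eq_max_parent S _ n]
        exact le_max_right _ _
    · rw [hsum]
      exact (le_stageMax S (bvec S B yh) n i).trans
        ((Int.le_ceil _).trans (Int.cast_le.2 (ceil_le_pmc S _ n i)))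
    · have h1 := S.stage_parent_add_one hn
      have h2 := S.stage_le n
      rw [heta (S.parent n) (by omega)]
      exact Finset.le_sup' (fun m => (∑ i, f (S.stage m) i * ∑ l ∈ S.path m, (xTS l i : ℝ))
          + (∑ j, c (S.stage m) j * yh m j) - uh m) (by simp [STree.children, hn])
    · by_cases hn : n = S.root
      · subst hn
        rw [S.eq_root_of_stage_eq hmn]
      · funext i
        rw [hxn n hn, hxn m (S.ne_root_of_stage_eq hmn hn), pmc_congr_stage S hstage n m hmn,
          pmc_congr_stage S hstage _ _ (S.stage_parent_eq hmn hn)]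
  have hopt (x η) (h : FeasTS S f c B yh uh x η) :
      Gobj S p f lam xTS etaTS ≤ Gobj S p f lam x η := by
    have hx (n : S.Node) (i : Fin M) :
        ∑ m ∈ S.path n, (xTS m i : ℝ) ≤ ∑ m ∈ S.path n, (x m i : ℝ) :=
      (hsum n i).trans_le (h.pmc_le_sum_path S n i)
    refine Gobj_le_Gobj S hp hf hlam hx fun n hn => ?_
    rw [heta n hn]
    refine Finset.sup'_le _ _ fun m hm => ?_
    obtain ⟨hmr, rfl⟩ : m ≠ S.root ∧ S.parent m = n := by simpa [STree.children] using hm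
    refine le_trans ?_ (h.1.2.2 m hmr)
    gcongr ∑ i, _ * ?_ + _ - _ with i
    · exact hf _ (S.stage_ge m) (S.stage_le m) i
    · exact hx m i
  refine ⟨hfeas, hopt, ?_⟩
  have hleast : IsLeast {v : ℝ | ∃ x η, FeasTS S f c B yh uh x η ∧ v = Gobj S p f lam x η}
      (Gobj S p f lam xTS etaTS) :=
    ⟨⟨xTS, etaTS, hfeas, rfl⟩, by rintro _ ⟨x, η, h, rfl⟩; exact hopt x η h⟩
  rw [hleast.csInf_eq]
  refine Finset.sum_congr rfl fun n _ => ?_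
  simp only [hsum]
  by_cases hn : S.stage n = T
  · simp [hn]
  · rw [if_neg hn, dif_neg hn, heta n hn]
    simp only [hsum]
end

section
/- (Proposition 1.) Assume f_s ≥ 0 and c_s ≥ 0 componentwise for every stage s, α_s ∈ [0,1) for s = 2,…,T, and that the multistage feasible set and the two-stage feasible set are nonempty. For a vector of risk parameters λ = (λ_2,…,λ_T) ∈ [0,1]^{T−1}, write F_λ for the objective F with derived coefficients f̃, c̃, λ̃, α̃ built from λ, and write z^MS(λ) and z^TS(λ) for the infima of F_λ over the multistage-feasible, respectively two-stage-feasible, tuples (these feasible sets do not depend on λ, and F_λ ≥ 0 on them, so the infima are real numbers). Then for any λ, λ' ∈ [0,1]^{T−1} with λ_s ≤ λ'_s for every s = 2,…,T, one has z^MS(λ) ≤ z^MS(λ') and z^TS(λ) ≤ z^TS(λ'): both optimal values are nondecreasing in the risk-aversion parameters. -/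
open Finset

section CapacityModel

variable {T M N J : ℕ}

/-- Multistage feasibility (with the capacity variables `x` taken real, for LP
relaxations; the integer model uses the coercion of an integer `x`). -/
def MFeasR (S : STree T) (f : ℕ → Fin M → ℝ) (c : ℕ → Fin J → ℝ)
    (A : ℕ → Matrix (Fin N) (Fin J) ℝ) (B : ℕ → Matrix (Fin M) (Fin J) ℝ)
    (d : S.Node → Fin N → ℝ)
    (x : S.Node → Fin M → ℝ) (y : S.Node → Fin J → ℝ) (η u : S.Node → ℝ) : Prop :=
  (∀ n i, 0 ≤ x n i) ∧ (∀ n j, 0 ≤ y n j) ∧ (∀ n, n ≠ S.root → 0 ≤ u n) ∧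
  (∀ n, (A (S.stage n)).mulVec (y n) = d n) ∧
  (∀ n i, (B (S.stage n)).mulVec (y n) i ≤ ∑ m ∈ S.path n, x m i) ∧
  ∀ n, n ≠ S.root →
    (∑ i, f (S.stage n) i * ∑ m ∈ S.path n, x m i) + (∑ j, c (S.stage n) j * y n j)
      ≤ u n + η (S.parent n)

/-- The two-stage (non-anticipativity) constraint: capacity decisions agree on
nodes of the same stage. -/
def TSconstr (S : STree T) (x : S.Node → Fin M → ℝ) : Prop :=
  ∀ m n, S.stage m = S.stage n → x m = x n

/-- The risk-averse objective
`F(x,y,η,u) = ∑_n p_n ( f̃_n·∑_{m∈𝒫(n)} x_m + c̃_n·y_n + λ̃_n η_n + α̃_n u_n )`,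
where `f̃, c̃, λ̃, α̃` are the derived ECRM coefficients. -/
noncomputable def FR (S : STree T) (p : S.Node → ℝ) (f : ℕ → Fin M → ℝ) (c : ℕ → Fin J → ℝ)
    (lam alpha : ℕ → ℝ)
    (x : S.Node → Fin M → ℝ) (y : S.Node → Fin J → ℝ) (η u : S.Node → ℝ) : ℝ :=
  ∑ n, p n *
    ((∑ i, (if n = S.root then f 1 i else (1 - lam (S.stage n)) * f (S.stage n) i)
        * ∑ m ∈ S.path n, x m i)
     + (∑ j, (if n = S.root then c 1 j else (1 - lam (S.stage n)) * c (S.stage n) j) * y n j)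
     + (if S.stage n = T then 0 else lam (S.stage n + 1)) * η n
     + (if n = S.root then 0 else lam (S.stage n) / (1 - alpha (S.stage n))) * u n)

/-- Optimal value of the risk-averse multistage model (integer capacities). -/
noncomputable def zMS (S : STree T) (p : S.Node → ℝ) (f : ℕ → Fin M → ℝ) (c : ℕ → Fin J → ℝ)
    (A : ℕ → Matrix (Fin N) (Fin J) ℝ) (B : ℕ → Matrix (Fin M) (Fin J) ℝ)
    (d : S.Node → Fin N → ℝ) (lam alpha : ℕ → ℝ) : ℝ :=
  sInf {v : ℝ | ∃ (x : S.Node → Fin M → ℤ) (y : S.Node → Fin J → ℝ) (η u : S.Node → ℝ),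
    MFeasR S f c A B d (fun n i => (x n i : ℝ)) y η u ∧
    v = FR S p f c lam alpha (fun n i => (x n i : ℝ)) y η u}

/-- Optimal value of the risk-averse two-stage model (integer capacities). -/
noncomputable def zTS (S : STree T) (p : S.Node → ℝ) (f : ℕ → Fin M → ℝ) (c : ℕ → Fin J → ℝ)
    (A : ℕ → Matrix (Fin N) (Fin J) ℝ) (B : ℕ → Matrix (Fin M) (Fin J) ℝ)
    (d : S.Node → Fin N → ℝ) (lam alpha : ℕ → ℝ) : ℝ :=
  sInf {v : ℝ | ∃ (x : S.Node → Fin M → ℤ) (y : S.Node → Fin J → ℝ) (η u : S.Node → ℝ),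
    MFeasR S f c A B d (fun n i => (x n i : ℝ)) y η u ∧
    TSconstr S (fun n i => (x n i : ℝ)) ∧
    v = FR S p f c lam alpha (fun n i => (x n i : ℝ)) y η u}

end CapacityModel

namespace STree

variable {T : ℕ} (S : STree T)

theorem stage_eq_stage_parent_add_one {n : S.Node} (h : n ≠ S.root) :
    S.stage n = S.stage (S.parent n) + 1 := by
  have h1 := S.stage_parent n h
  have h2 := S.stage_ge (S.parent n)
  omega

theorem two_le_stage {n : S.Node} (h : n ≠ S.root) : 2 ≤ S.stage n := by
  have h1 := S.stage_eq_stage_parent_add_one h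
  have h2 := S.stage_ge (S.parent n)
  omega

theorem stage_parent_ne {n : S.Node} (h : n ≠ S.root) : S.stage (S.parent n) ≠ T := by
  have h1 := S.stage_eq_stage_parent_add_one h
  have h2 := S.stage_le n
  omega

/-- A sum over non-leaf nodes weighted by node probabilities can be moved to the children. -/
theorem sum_mul_nonleaf_eq_sum_mul_parent {p : S.Node → ℝ}
    (hpc : ∀ n, S.stage n ≠ T → ∑ m ∈ S.children n, p m = p n) (w : ℕ → ℝ) (η : S.Node → ℝ) :
    ∑ n, p n * ((if S.stage n = T then 0 else w (S.stage n + 1)) * η n) =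
      ∑ n, p n * (if n = S.root then 0 else w (S.stage n) * η (S.parent n)) := by
  rw [← Finset.sum_fiberwise Finset.univ S.parent
    (fun n => p n * (if n = S.root then 0 else w (S.stage n) * η (S.parent n)))]
  refine Finset.sum_congr rfl fun n _ => ?_
  have hchildren : ∑ m with S.parent m = n,
      p m * (if m = S.root then 0 else w (S.stage m) * η (S.parent m)) =
      ∑ m ∈ S.children n, p m * (w (S.stage n + 1) * η n) := by
    rw [children, Finset.sum_filter, Finset.sum_filter]
    refine Finset.sum_congr rfl fun m _ => ?_
    by_cases hm : m = S.root
    · simp [hm]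
    · by_cases hmn : S.parent m = n
      · subst hmn
        simp [hm, S.stage_eq_stage_parent_add_one hm]
      · simp [hmn]
  rw [hchildren]
  by_cases hn : S.stage n = T
  · have hempty : S.children n = ∅ := by
      refine Finset.filter_eq_empty_iff.mpr fun m _ hm => ?_
      exact S.stage_parent_ne hm.1 (hm.2 ▸ hn)
    simp [hn, hempty]
  · rw [← Finset.sum_mul, hpc n hn, if_neg hn]

end STree

section CapacityModel

variable {T M N J : ℕ}

/-- The expansion and allocation cost incurred at a node. -/
noncomputable def nodeCost (S : STree T) (f : ℕ → Fin M → ℝ) (c : ℕ → Fin J → ℝ)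
    (x : S.Node → Fin M → ℝ) (y : S.Node → Fin J → ℝ) (n : S.Node) : ℝ :=
  (∑ i, f (S.stage n) i * ∑ m ∈ S.path n, x m i) + ∑ j, c (S.stage n) j * y n j

/-- The objective as an expectation of nodewise costs, each non-root node carrying the
value-at-risk variable of its parent. -/
theorem FR_eq_sum_nodeCost (S : STree T) {p : S.Node → ℝ}
    (hpc : ∀ n, S.stage n ≠ T → ∑ m ∈ S.children n, p m = p n)
    (f : ℕ → Fin M → ℝ) (c : ℕ → Fin J → ℝ) (lam alpha : ℕ → ℝ)
    (x : S.Node → Fin M → ℝ) (y : S.Node → Fin J → ℝ) (η u : S.Node → ℝ) :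
    FR S p f c lam alpha x y η u =
      ∑ n, p n * (if n = S.root then nodeCost S f c x y n else
        (1 - lam (S.stage n)) * nodeCost S f c x y n +
          lam (S.stage n) * (η (S.parent n) + u n / (1 - alpha (S.stage n)))) := by
  have hη := S.sum_mul_nonleaf_eq_sum_mul_parent hpc lam η
  simp only [FR, mul_add, Finset.sum_add_distrib] at hη ⊢
  rw [hη]
  simp only [← Finset.sum_add_distrib]
  refine Finset.sum_congr rfl fun n _ => ?_
  by_cases hn : n = S.root
  · simp [hn, nodeCost, S.stage_root, mul_add]
  · simp only [hn, if_false, nodeCost, mul_add, mul_assoc, ← Finset.mul_sum]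
    ring

/-- At a feasible point, the tail term at a non-root node dominates the node cost. -/
theorem MFeasR.nodeCost_le {S : STree T} {f : ℕ → Fin M → ℝ} {c : ℕ → Fin J → ℝ}
    {A : ℕ → Matrix (Fin N) (Fin J) ℝ} {B : ℕ → Matrix (Fin M) (Fin J) ℝ}
    {d : S.Node → Fin N → ℝ} {alpha : ℕ → ℝ}
    (halpha : ∀ s, 2 ≤ s → s ≤ T → 0 ≤ alpha s ∧ alpha s < 1)
    {x : S.Node → Fin M → ℝ} {y : S.Node → Fin J → ℝ} {η u : S.Node → ℝ}
    (h : MFeasR S f c A B d x y η u) {n : S.Node} (hn : n ≠ S.root) :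
    nodeCost S f c x y n ≤ η (S.parent n) + u n / (1 - alpha (S.stage n)) := by
  obtain ⟨-, -, hu, -, -, hcut⟩ := h
  obtain ⟨h0, h1⟩ := halpha _ (S.two_le_stage hn) (S.stage_le n)
  have hdiv : u n ≤ u n / (1 - alpha (S.stage n)) :=
    le_div_self (hu n hn) (by linarith) (by linarith)
  have := hcut n hn
  rw [nodeCost]
  linarith

theorem MFeasR.nodeCost_nonneg {S : STree T} {f : ℕ → Fin M → ℝ} {c : ℕ → Fin J → ℝ}
    {A : ℕ → Matrix (Fin N) (Fin J) ℝ} {B : ℕ → Matrix (Fin M) (Fin J) ℝ}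
    {d : S.Node → Fin N → ℝ}
    (hf : ∀ s, 1 ≤ s → s ≤ T → ∀ i, 0 ≤ f s i) (hc : ∀ s, 1 ≤ s → s ≤ T → ∀ j, 0 ≤ c s j)
    {x : S.Node → Fin M → ℝ} {y : S.Node → Fin J → ℝ} {η u : S.Node → ℝ}
    (h : MFeasR S f c A B d x y η u) (n : S.Node) : 0 ≤ nodeCost S f c x y n :=
  add_nonneg
    (Finset.sum_nonneg fun i _ => mul_nonneg (hf _ (S.stage_ge n) (S.stage_le n) i)
      (Finset.sum_nonneg fun m _ => h.1 m i))
    (Finset.sum_nonneg fun j _ => mul_nonneg (hc _ (S.stage_ge n) (S.stage_le n) j) (h.2.1 n j))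

/-- At each feasible point the objective is monotone in the risk weights. -/
theorem MFeasR.FR_le_FR {S : STree T} {p : S.Node → ℝ} {f : ℕ → Fin M → ℝ} {c : ℕ → Fin J → ℝ}
    {A : ℕ → Matrix (Fin N) (Fin J) ℝ} {B : ℕ → Matrix (Fin M) (Fin J) ℝ}
    {d : S.Node → Fin N → ℝ} {lam lam' alpha : ℕ → ℝ}
    (hp : ∀ n, 0 ≤ p n) (hpc : ∀ n, S.stage n ≠ T → ∑ m ∈ S.children n, p m = p n)
    (halpha : ∀ s, 2 ≤ s → s ≤ T → 0 ≤ alpha s ∧ alpha s < 1)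
    (hle : ∀ s, 2 ≤ s → s ≤ T → lam s ≤ lam' s)
    {x : S.Node → Fin M → ℝ} {y : S.Node → Fin J → ℝ} {η u : S.Node → ℝ}
    (h : MFeasR S f c A B d x y η u) :
    FR S p f c lam alpha x y η u ≤ FR S p f c lam' alpha x y η u := by
  rw [FR_eq_sum_nodeCost S hpc, FR_eq_sum_nodeCost S hpc]
  refine Finset.sum_le_sum fun n _ => mul_le_mul_of_nonneg_left ?_ (hp n)
  by_cases hn : n = S.root
  · simp [hn]
  · rw [if_neg hn, if_neg hn]
    have hcost := h.nodeCost_le halpha hn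
    have hlam := hle _ (S.two_le_stage hn) (S.stage_le n)
    linarith [mul_nonneg (sub_nonneg.mpr hlam) (sub_nonneg.mpr hcost)]

/-- At each feasible point the objective is nonnegative. -/
theorem MFeasR.FR_nonneg {S : STree T} {p : S.Node → ℝ} {f : ℕ → Fin M → ℝ} {c : ℕ → Fin J → ℝ}
    {A : ℕ → Matrix (Fin N) (Fin J) ℝ} {B : ℕ → Matrix (Fin M) (Fin J) ℝ}
    {d : S.Node → Fin N → ℝ} {lam alpha : ℕ → ℝ}
    (hp : ∀ n, 0 ≤ p n) (hpc : ∀ n, S.stage n ≠ T → ∑ m ∈ S.children n, p m = p n)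
    (hf : ∀ s, 1 ≤ s → s ≤ T → ∀ i, 0 ≤ f s i) (hc : ∀ s, 1 ≤ s → s ≤ T → ∀ j, 0 ≤ c s j)
    (halpha : ∀ s, 2 ≤ s → s ≤ T → 0 ≤ alpha s ∧ alpha s < 1)
    (hlam : ∀ s, 2 ≤ s → s ≤ T → 0 ≤ lam s)
    {x : S.Node → Fin M → ℝ} {y : S.Node → Fin J → ℝ} {η u : S.Node → ℝ}
    (h : MFeasR S f c A B d x y η u) :
    0 ≤ FR S p f c lam alpha x y η u := by
  refine le_trans ?_ (h.FR_le_FR (lam := fun _ => 0) hp hpc halpha hlam)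
  rw [FR_eq_sum_nodeCost S hpc]
  refine Finset.sum_nonneg fun n _ => mul_nonneg (hp n) ?_
  simpa using h.nodeCost_nonneg hf hc n

end CapacityModel

/-- Proposition 1: the optimal values of the risk-averse multistage
and two-stage models are nondecreasing in the risk-aversion parameters `λ`. -/
theorem optimal_values_monotone_in_risk {T M N J : ℕ} (S : STree T)
    (p : S.Node → ℝ) (f : ℕ → Fin M → ℝ) (c : ℕ → Fin J → ℝ)
    (A : ℕ → Matrix (Fin N) (Fin J) ℝ) (B : ℕ → Matrix (Fin M) (Fin J) ℝ)
    (d : S.Node → Fin N → ℝ) (alpha : ℕ → ℝ)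
    (hp : ∀ n, 0 ≤ p n)
    (hp1 : ∀ s, 1 ≤ s → s ≤ T → ∑ n ∈ S.stageNodes s, p n = 1)
    (hpc : ∀ n, S.stage n ≠ T → ∑ m ∈ S.children n, p m = p n)
    (hf : ∀ s, 1 ≤ s → s ≤ T → ∀ i, 0 ≤ f s i)
    (hc : ∀ s, 1 ≤ s → s ≤ T → ∀ j, 0 ≤ c s j)
    (halpha : ∀ s, 2 ≤ s → s ≤ T → 0 ≤ alpha s ∧ alpha s < 1)
    (hMne : ∃ (x : S.Node → Fin M → ℤ) (y : S.Node → Fin J → ℝ) (η u : S.Node → ℝ),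
      MFeasR S f c A B d (fun n i => (x n i : ℝ)) y η u)
    (hTne : ∃ (x : S.Node → Fin M → ℤ) (y : S.Node → Fin J → ℝ) (η u : S.Node → ℝ),
      MFeasR S f c A B d (fun n i => (x n i : ℝ)) y η u ∧
      TSconstr S (fun n i => (x n i : ℝ)))
    (lam lam' : ℕ → ℝ)
    (hlam : ∀ s, 2 ≤ s → s ≤ T → 0 ≤ lam s ∧ lam s ≤ 1)
    (hlam' : ∀ s, 2 ≤ s → s ≤ T → 0 ≤ lam' s ∧ lam' s ≤ 1)
    (hle : ∀ s, 2 ≤ s → s ≤ T → lam s ≤ lam' s) :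
    zMS S p f c A B d lam alpha ≤ zMS S p f c A B d lam' alpha ∧
    zTS S p f c A B d lam alpha ≤ zTS S p f c A B d lam' alpha := by
  constructor
  · obtain ⟨x, y, η, u, h⟩ := hMne
    refine le_csInf ⟨_, x, y, η, u, h, rfl⟩ ?_
    rintro _ ⟨x, y, η, u, h, rfl⟩
    refine csInf_le_of_le ⟨0, ?_⟩ ⟨x, y, η, u, h, rfl⟩ (h.FR_le_FR hp hpc halpha hle)
    rintro _ ⟨x, y, η, u, h, rfl⟩
    exact h.FR_nonneg hp hpc hf hc halpha fun s h2 hT => (hlam s h2 hT).1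
  · obtain ⟨x, y, η, u, h, hx⟩ := hTne
    refine le_csInf ⟨_, x, y, η, u, h, hx, rfl⟩ ?_
    rintro _ ⟨x, y, η, u, h, hx, rfl⟩
    refine csInf_le_of_le ⟨0, ?_⟩ ⟨x, y, η, u, h, hx, rfl⟩ (h.FR_le_FR hp hpc halpha hle)
    rintro _ ⟨x, y, η, u, h, -, rfl⟩
    exact h.FR_nonneg hp hpc hf hc halpha fun s h2 hT => (hlam s h2 hT).1
end
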